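/- Let L ≥ 2 be an integer and r > 0. Let N_1 ≥ N_2 ≥ ⋯ ≥ N_L be positive integers and, for each l = 1, …, L−1, let W_l be a real N_{l+1}×N_l matrix with σ_l = ‖W_l‖, let O_l be a semi-orthogonal real N_{l+1}×N_l matrix, and let d_l ∈ [0,r]^{N_{l+1}}. Set σ_max = max_{1 ≤ l ≤ L−1} σ_l and suppose 0 < α < 1/(1 + r·σ_max). Then the product matrix J = (α·diag(d_{L−1})·W_{L−1} + (1−α)·O_{L−1}) ⋯ (α·diag(d_1)·W_1 + (1−α)·O_1), taken in the order l = L−1 down to l = 1, satisfies ‖J‖ ≥ ∏_{l=1}^{L−1} (1 − α(1 + r·σ_l)). -/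

import Mathlib

open Matrix

/-- A real `N × M` matrix is semi-orthogonal: `Aᵀ * A = 1` when `M < N`,
and `A * Aᵀ = 1` when `M ≥ N`. -/
def IsSemiOrthogonal {N M : ℕ} (A : Matrix (Fin N) (Fin M) ℝ) : Prop :=
  if M < N then Aᵀ * A = 1 else A * Aᵀ = 1

/-- The operator norm of a real matrix induced by the Euclidean vector norms
(i.e. the largest singular value). -/
noncomputable def opNorm {m n : ℕ} (A : Matrix (Fin m) (Fin n) ℝ) : ℝ :=
  ‖LinearMap.toContinuousLinearMap (Matrix.toEuclideanLin A)‖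

section
open scoped Matrix.Norms.L2Operator

theorem opNorm_eq {m n : ℕ} (A : Matrix (Fin m) (Fin n) ℝ) : opNorm A = ‖A‖ := by
  rw [Matrix.l2_opNorm_def]
  rfl

theorem opNorm_nonneg' {m n : ℕ} (A : Matrix (Fin m) (Fin n) ℝ) : 0 ≤ opNorm A :=
  norm_nonneg _

theorem opNorm_one' {m : ℕ} (hm : 0 < m) : opNorm (1 : Matrix (Fin m) (Fin m) ℝ) = 1 := by
  rw [opNorm_eq]
  haveI : Nonempty (Fin m) := ⟨⟨0, hm⟩⟩
  rw [← Matrix.diagonal_one, Matrix.l2_opNorm_diagonal]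
  exact (pi_norm_const (1 : ℝ)).trans norm_one

theorem step_bound {k m n : ℕ} (hm : 0 < m) (r α : ℝ) (hr : 0 < r) (hα0 : 0 < α) (hα1 : α ≤ 1)
    (P : Matrix (Fin k) (Fin m) ℝ) (W O : Matrix (Fin m) (Fin n) ℝ) (hO : O * Oᵀ = 1)
    (d : Fin m → ℝ) (hd : ∀ i, d i ∈ Set.Icc (0 : ℝ) r) :
    (1 - α * (1 + r * opNorm W)) * opNorm P
      ≤ opNorm (P * (α • (Matrix.diagonal d * W) + (1 - α) • O)) := by
  have h1 := opNorm_one' hm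
  simp only [opNorm_eq] at *
  have hOt : ‖Oᵀ‖ = 1 := by
    have h := Matrix.l2_opNorm_conjTranspose_mul_self (Oᵀ)
    rw [Matrix.conjTranspose_eq_transpose_of_trivial, Matrix.transpose_transpose, hO, h1] at h
    nlinarith [norm_nonneg (Oᵀ)]
  have hPO : ‖P‖ ≤ ‖P * O‖ := by
    have h := Matrix.l2_opNorm_mul (P * O) Oᵀ
    rwa [Matrix.mul_assoc, hO, Matrix.mul_one, hOt, mul_one] at h
  have hD : ‖(Matrix.diagonal d : Matrix (Fin m) (Fin m) ℝ)‖ ≤ r := by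
    rw [Matrix.l2_opNorm_diagonal, pi_norm_le_iff_of_nonneg hr.le]
    intro i
    rw [Real.norm_eq_abs, abs_of_nonneg (hd i).1]
    exact (hd i).2
  have hPDW : ‖P * (Matrix.diagonal d * W)‖ ≤ ‖P‖ * (r * ‖W‖) := by
    refine (Matrix.l2_opNorm_mul _ _).trans ?_
    gcongr
    refine (Matrix.l2_opNorm_mul _ _).trans ?_
    gcongr
  have e : (1 - α) • (P * O) = P * (α • (Matrix.diagonal d * W) + (1 - α) • O)
      - α • (P * (Matrix.diagonal d * W)) := by
    rw [Matrix.mul_add, Matrix.mul_smul, Matrix.mul_smul]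
    abel
  have h2 := norm_sub_le (P * (α • (Matrix.diagonal d * W) + (1 - α) • O))
    (α • (P * (Matrix.diagonal d * W)))
  rw [← e, norm_smul, norm_smul, Real.norm_eq_abs, Real.norm_eq_abs, abs_of_pos hα0,
    abs_of_nonneg (sub_nonneg.2 hα1)] at h2
  have h3 := mul_le_mul_of_nonneg_left hPO (sub_nonneg.2 hα1)
  have h4 := mul_le_mul_of_nonneg_left hPDW hα0.le
  linarith

end

/-- Iterated form of Lemma 3: with nonincreasing layer dimensions and
`0 < α < 1/(1 + r σ_max)`, the input-output Jacobian `J = P 1`, encoded by the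
backward recursion `P L = 1`, `P l = P (l+1) * (α • diag (d l) * W l + (1-α) • O l)`,
satisfies `‖J‖ ≥ ∏_{l=1}^{L-1} (1 - α (1 + r σ_l))` where `σ_l = ‖W l‖`. -/
theorem roaFNN_IOJ_product_lower_bound
    (L : ℕ) (hL : 2 ≤ L) (r α : ℝ) (hr : 0 < r)
    (N : ℕ → ℕ) (hN : ∀ l, 0 < N l)
    (hmono : ∀ l, 1 ≤ l → l + 1 ≤ L → N (l + 1) ≤ N l)
    (W : ∀ l : ℕ, Matrix (Fin (N (l + 1))) (Fin (N l)) ℝ)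
    (O : ∀ l : ℕ, Matrix (Fin (N (l + 1))) (Fin (N l)) ℝ)
    (hO : ∀ l, 1 ≤ l → l ≤ L - 1 → IsSemiOrthogonal (O l))
    (d : ∀ l : ℕ, Fin (N (l + 1)) → ℝ)
    (hd : ∀ l, 1 ≤ l → l ≤ L - 1 → ∀ i, d l i ∈ Set.Icc (0 : ℝ) r)
    (σmax : ℝ)
    (hσ : σmax = (Finset.Icc 1 (L - 1)).sup'
      (Finset.nonempty_Icc.mpr (by omega)) fun l => opNorm (W l))
    (hα0 : 0 < α) (hα1 : α < 1 / (1 + r * σmax))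
    (P : ∀ l : ℕ, Matrix (Fin (N L)) (Fin (N l)) ℝ)
    (hPL : P L = 1)
    (hPrec : ∀ l, 1 ≤ l → l ≤ L - 1 →
      P l = P (l + 1) * (α • (Matrix.diagonal (d l) * W l) + (1 - α) • O l)) :
    ∏ l ∈ Finset.Icc 1 (L - 1), (1 - α * (1 + r * opNorm (W l))) ≤ opNorm (P 1) := by
  have hle : ∀ l, 1 ≤ l → l ≤ L - 1 → opNorm (W l) ≤ σmax := by
    intro l h1 h2
    rw [hσ]
    exact Finset.le_sup' (fun l => opNorm (W l)) (Finset.mem_Icc.2 ⟨h1, h2⟩)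
  have hσ0 : 0 ≤ σmax := (opNorm_nonneg' (W 1)).trans (hle 1 le_rfl (by omega))
  have hrs : 0 ≤ r * σmax := mul_nonneg hr.le hσ0
  have hα2 : α * (1 + r * σmax) < 1 := (lt_div_iff₀ (by linarith)).1 hα1
  have hα3 : α ≤ 1 := by nlinarith
  have hfac : ∀ l, 1 ≤ l → l ≤ L - 1 → 0 ≤ 1 - α * (1 + r * opNorm (W l)) := by
    intro l h1 h2
    have h3 := mul_le_mul_of_nonneg_left (hle l h1 h2) (mul_pos hα0 hr).le
    linarith
  have key : ∀ k l, l + k = L → 1 ≤ l →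
      ∏ l ∈ Finset.Ico l L, (1 - α * (1 + r * opNorm (W l))) ≤ opNorm (P l) := by
    intro k
    induction k with
    | zero =>
      intro l h _
      obtain rfl : l = L := by omega
      rw [Finset.Ico_self, Finset.prod_empty, hPL, opNorm_one' (hN _)]
    | succ k ih =>
      intro l h h1
      have h2 : l ≤ L - 1 := by omega
      have hOl := hO l h1 h2
      unfold IsSemiOrthogonal at hOl
      rw [if_neg (not_lt.2 (hmono l h1 (by omega)))] at hOl
      rw [Finset.prod_eq_prod_Ico_succ_bot (by omega), hPrec l h1 h2]
      exact (mul_le_mul_of_nonneg_left (ih (l + 1) (by omega) (by omega)) (hfac l h1 h2)).trans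
        (step_bound (hN _) r α hr hα0 hα3 _ _ _ hOl _ (hd l h1 h2))
  have hI : Finset.Icc 1 (L - 1) = Finset.Ico 1 L := by
    ext x
    simp only [Finset.mem_Icc, Finset.mem_Ico]
    omega
  rw [hI]
  exact key (L - 1) 1 (by omega) le_rfl
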